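/- Let π be a group, Λ = ℤ[π] its integral group ring, and M a Λ-module. If there exists a Λ-linear isomorphism M × Λⁿ ≃ Λⁿ for some n, then M is trivial (M has at most one element). -/

import Mathlib

open Filter Topology

/-- The trace on a matrix algebra induced by a linear functional on the coefficients. -/
noncomputable def matrixTrace {R : Type*} [Ring R] [Algebra ℝ R] (τ : R →ₗ[ℝ] ℝ) (n : Type*)
    [Fintype n] : Matrix n n R →ₗ[ℝ] ℝ :=
  τ ∘ₗ Matrix.traceLinearMap n ℝ R

lemma matrixTrace_mul {R n : Type*} [Ring R] [Algebra ℝ R] [Fintype n] (τ : R →ₗ[ℝ] ℝ)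
    (A B : Matrix n n R) :
    matrixTrace τ n (A * B) = ∑ i, ∑ j, τ (A i j * B j i) := by
  simp [matrixTrace, Matrix.trace, Matrix.mul_apply]

section FaithfulTrace

variable {R : Type*} [Ring R] [StarRing R] [Algebra ℝ R]

/-- A faithful positive real-valued trace on a real star algebra. -/
structure IsFaithfulTrace (τ : R →ₗ[ℝ] ℝ) : Prop where
  mul_comm : ∀ x y, τ (x * y) = τ (y * x)
  nonneg : ∀ x, 0 ≤ τ (star x * x)
  eq_zero : ∀ x, τ (star x * x) = 0 → x = 0

/-- Left multiplication by `a` is bounded for the quadratic form `x ↦ τ (star x * x)`. -/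
def IsLeftBounded (τ : R →ₗ[ℝ] ℝ) (a : R) : Prop :=
  ∃ C : ℝ, ∀ x, τ (star (a * x) * (a * x)) ≤ C * τ (star x * x)

namespace IsFaithfulTrace

variable {τ : R →ₗ[ℝ] ℝ}

lemma add_le (hτ : IsFaithfulTrace τ) (x y : R) :
    τ (star (x + y) * (x + y)) ≤ 2 * τ (star x * x) + 2 * τ (star y * y) := by
  have h := hτ.nonneg (x - y)
  simp only [star_sub, star_add, sub_mul, mul_sub, add_mul, mul_add, map_add, map_sub] at h ⊢
  linarith

lemma isLeftBounded_add (hτ : IsFaithfulTrace τ) {a b : R} (ha : IsLeftBounded τ a)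
    (hb : IsLeftBounded τ b) : IsLeftBounded τ (a + b) := by
  obtain ⟨C, hC⟩ := ha
  obtain ⟨D, hD⟩ := hb
  refine ⟨2 * C + 2 * D, fun x ↦ ?_⟩
  rw [add_mul]
  linarith [hτ.add_le (a * x) (b * x), hC x, hD x]

lemma exists_one_le_bound (hτ : IsFaithfulTrace τ) {a : R} (ha : IsLeftBounded τ a) :
    ∃ C : ℝ, 1 ≤ C ∧ ∀ x, τ (star (a * x) * (a * x)) ≤ C * τ (star x * x) := by
  obtain ⟨C, hC⟩ := ha
  exact ⟨max 1 C, le_max_left _ _, fun x ↦ (hC x).trans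
    (mul_le_mul_of_nonneg_right (le_max_right _ _) (hτ.nonneg x))⟩

variable [StarModule ℝ R]

/-- If `b` has a left inverse, then `1 - ε • (star b * b)` is a strict contraction for some `ε`. -/
lemma exists_contraction (hτ : IsFaithfulTrace τ) (hb : ∀ a, IsLeftBounded τ a) {a b : R}
    (hab : a * b = 1) :
    ∃ ε r : ℝ, 0 ≤ r ∧ r < 1 ∧ ∀ x, τ (star ((1 - ε • (star b * b)) * x) *
      ((1 - ε • (star b * b)) * x)) ≤ r * τ (star x * x) := by
  obtain ⟨C, hC1, hC⟩ := hτ.exists_one_le_bound (hb a)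
  obtain ⟨D, hD1, hD⟩ := hτ.exists_one_le_bound (hb (star b * b))
  have hC0 : 0 < C := by linarith
  have hD0 : 0 < D := by linarith
  have hCD : 1 ≤ C * D := one_le_mul_of_one_le_of_one_le hC1 hD1
  have hCCD : 1 ≤ C * (C * D) := one_le_mul_of_one_le_of_one_le hC1 hCD
  refine ⟨1 / (C * D), 1 - 1 / (C * (C * D)), ?_, ?_, fun x ↦ ?_⟩
  · rw [sub_nonneg, div_le_one (by positivity)]
    exact hCCD
  · have : 0 < 1 / (C * (C * D)) := by positivity
    linarith
  · have h1 := hC (b * x)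
    rw [← mul_assoc a b x, hab, one_mul] at h1
    have h2 := hD x
    have key : τ (star ((1 - (1 / (C * D)) • (star b * b)) * x) *
        ((1 - (1 / (C * D)) • (star b * b)) * x)) =
        τ (star x * x) - 2 * (1 / (C * D)) * τ (star (b * x) * (b * x)) +
        (1 / (C * D)) ^ 2 * τ (star (star b * b * x) * (star b * b * x)) := by
      simp only [sub_mul, mul_sub, one_mul, star_sub, smul_mul_assoc, mul_smul_comm, star_smul,
        star_mul, star_star, map_sub, map_smul, smul_eq_mul, star_trivial, mul_assoc]
      ring
    rw [key]
    have h3 : (1 / (C * D)) * τ (star x * x) / C ≤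
        (1 / (C * D)) * τ (star (b * x) * (b * x)) := by
      rw [mul_div_assoc]
      refine mul_le_mul_of_nonneg_left ?_ (by positivity)
      rw [div_le_iff₀ hC0]
      linarith
    have h4 : (1 / (C * D)) ^ 2 * τ (star (star b * b * x) * (star b * b * x)) ≤
        (1 / (C * D)) * τ (star x * x) / C := by
      calc _ ≤ (1 / (C * D)) ^ 2 * (D * τ (star x * x)) :=
            mul_le_mul_of_nonneg_left h2 (by positivity)
        _ = _ := by field_simp
    have h5 : (1 - 1 / (C * (C * D))) * τ (star x * x) =
        τ (star x * x) - (1 / (C * D)) * τ (star x * x) / C := by field_simp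
    linarith

/-- A real star algebra with a faithful positive trace, all of whose left multiplications are
bounded, is Dedekind-finite. -/
theorem isDedekindFiniteMonoid (hτ : IsFaithfulTrace τ) (hb : ∀ a, IsLeftBounded τ a) :
    IsDedekindFiniteMonoid R where
  mul_eq_one_symm {a b} hab := by
    obtain ⟨ε, r, hr0, hr1, hr⟩ := hτ.exists_contraction hb hab
    set h := star b * b with hh
    set u := 1 - ε • h with hu
    have hsh : star h = h := by simp [hh]
    have hsu : star u = u := by simp [hu, hsh]
    have hpow (k : ℕ) : τ (star (u ^ k) * u ^ k) ≤ r ^ k * τ (star 1 * 1) := by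
      induction k with
      | zero => simp
      | succ k ih =>
        rw [pow_succ' u]
        refine (hr _).trans ?_
        rw [pow_succ', mul_assoc]
        exact mul_le_mul_of_nonneg_left ih hr0
    obtain ⟨C, hC1, hC⟩ := hτ.exists_one_le_bound (hb (1 - b * a))
    have hbound (k : ℕ) : τ (star (1 - b * a) * (1 - b * a)) ≤ C * (r ^ k * τ (star 1 * 1)) := by
      set y : R := ε • ∑ i ∈ Finset.range k, u ^ i with hy
      have hsy : star y = y := by simp [hy, hsu]
      have hyh : y * h = 1 - u ^ k := by
        have h1 : (∑ i ∈ Finset.range k, u ^ i) * (1 - u) = 1 - u ^ k := geom_sum_mul_neg u k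
        rw [← h1, hy, hu, sub_sub_cancel, smul_mul_assoc, mul_smul_comm]
      set p : R := 1 - b * y * star b with hp
      have hsp : star p = p := by simp [hp, hsy, mul_assoc]
      have hep : (1 - b * a) * p = 1 - b * a := by
        have : (1 - b * a) * b = 0 := by rw [sub_mul, mul_assoc, hab]; simp
        rw [hp, mul_sub, mul_one, ← mul_assoc, ← mul_assoc, this]
        simp
      have h1 : τ (b * y * star b) = τ (y * h) := by
        rw [mul_assoc, hτ.mul_comm, mul_assoc]
      have h2 : τ (b * y * star b * (b * y * star b)) = τ (y * h * (y * h)) := by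
        rw [mul_assoc b y, mul_assoc b, hτ.mul_comm b]
        simp only [hh, mul_assoc]
      have hpu : τ (star p * p) = τ (star (u ^ k) * u ^ k) := by
        have huk : u ^ k = 1 - y * h := by rw [hyh]; simp
        rw [hsp, star_pow, hsu, huk, hp]
        simp only [sub_mul, mul_sub, mul_one, one_mul, map_sub, h1, h2]
      calc _ = τ (star ((1 - b * a) * p) * ((1 - b * a) * p)) := by rw [hep]
        _ ≤ C * τ (star p * p) := hC p
        _ ≤ _ := by
          rw [hpu]
          exact mul_le_mul_of_nonneg_left (hpow k) (by linarith)
    have hlim : Tendsto (fun k : ℕ ↦ C * (r ^ k * τ (star 1 * 1))) atTop (𝓝 0) := by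
      simpa using
        ((tendsto_pow_atTop_nhds_zero_of_lt_one hr0 hr1).mul_const (τ (star 1 * 1))).const_mul C
    have hle := ge_of_tendsto' hlim hbound
    exact (sub_eq_zero.mp (hτ.eq_zero _ (le_antisymm hle (hτ.nonneg _)))).symm

end IsFaithfulTrace

variable {τ : R →ₗ[ℝ] ℝ} {n : Type*} [Fintype n]

lemma matrixTrace_star_mul_self (τ : R →ₗ[ℝ] ℝ) (A : Matrix n n R) :
    matrixTrace τ n (star A * A) = ∑ i, ∑ j, τ (star (A j i) * A j i) := by
  simp [matrixTrace_mul, Matrix.star_apply]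

namespace IsFaithfulTrace

variable [DecidableEq n]

lemma matrix (hτ : IsFaithfulTrace τ) : IsFaithfulTrace (matrixTrace τ n) where
  mul_comm A B := by
    rw [matrixTrace_mul, matrixTrace_mul, Finset.sum_comm]
    simp only [hτ.mul_comm]
  nonneg A := by
    rw [matrixTrace_star_mul_self]
    exact Finset.sum_nonneg fun i _ ↦ Finset.sum_nonneg fun j _ ↦ hτ.nonneg _
  eq_zero A hA := by
    rw [matrixTrace_star_mul_self, Finset.sum_eq_zero_iff_of_nonneg
      fun i _ ↦ Finset.sum_nonneg fun j _ ↦ hτ.nonneg _] at hA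
    ext i j
    have h := hA j (Finset.mem_univ j)
    rw [Finset.sum_eq_zero_iff_of_nonneg fun i _ ↦ hτ.nonneg _] at h
    exact hτ.eq_zero _ (h i (Finset.mem_univ i))

lemma isLeftBounded_matrix (hτ : IsFaithfulTrace τ) (hb : ∀ a, IsLeftBounded τ a)
    (A : Matrix n n R) : IsLeftBounded (matrixTrace τ n) A := by
  induction A using Matrix.induction_on' with
  | h_zero => exact ⟨0, fun x ↦ by simp⟩
  | h_add A B hA hB => exact hτ.matrix.isLeftBounded_add hA hB
  | h_std_basis i j a =>
    obtain ⟨C, hC1, hC⟩ := hτ.exists_one_le_bound (hb a)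
    refine ⟨C, fun X ↦ ?_⟩
    rw [matrixTrace_star_mul_self, matrixTrace_star_mul_self, Finset.mul_sum]
    refine Finset.sum_le_sum fun l _ ↦ ?_
    rw [Finset.sum_eq_single i (fun k _ hk ↦ by
      rw [Matrix.single_mul_apply_of_ne _ _ _ _ _ hk]; simp) (by simp)]
    rw [Matrix.single_mul_apply_same]
    refine (hC _).trans (mul_le_mul_of_nonneg_left ?_ (by linarith))
    exact Finset.single_le_sum (f := fun k ↦ τ (star (X k l) * X k l))
      (fun k _ ↦ hτ.nonneg _) (Finset.mem_univ j)

theorem isStablyFiniteRing [StarModule ℝ R] (hτ : IsFaithfulTrace τ)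
    (hb : ∀ a, IsLeftBounded τ a) : IsStablyFiniteRing R where
  isDedekindFiniteMonoid _ := hτ.matrix.isDedekindFiniteMonoid (hτ.isLeftBounded_matrix hb)

end IsFaithfulTrace

end FaithfulTrace

namespace MonoidAlgebra

variable {G : Type*} [Group G]

/-- The anti-automorphism of the real group algebra that inverts group elements. -/
noncomputable def invAntiHom (G : Type*) [Group G] :
    MonoidAlgebra ℝ G →ₐ[ℝ] (MonoidAlgebra ℝ G)ᵐᵒᵖ :=
  lift ℝ _ G
    { toFun := fun g ↦ MulOpposite.op (single g⁻¹ 1)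
      map_one' := by simp [one_def]
      map_mul' := fun g h ↦ by simp [← MulOpposite.op_mul, single_mul_single] }

lemma unop_invAntiHom_single (g : G) (r : ℝ) :
    (invAntiHom G (single g r)).unop = single g⁻¹ r := by
  simp [invAntiHom, lift_single]

/-- The star ring structure on the real group algebra that inverts group elements. -/
noncomputable abbrev starRingOfInv (G : Type*) [Group G] : StarRing (MonoidAlgebra ℝ G) where
  star x := (invAntiHom G x).unop
  star_involutive x := by
    induction x using induction_linear with
    | zero => simp
    | add x y hx hy => simp only [map_add, MulOpposite.unop_add, hx, hy]
    | single g r => simp only [unop_invAntiHom_single, inv_inv]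
  star_mul x y := by simp
  star_add x y := by simp

attribute [local instance] starRingOfInv

lemma star_single_eq (g : G) (r : ℝ) : star (single g r) = single g⁻¹ r :=
  unop_invAntiHom_single g r

lemma starModule_real : StarModule ℝ (MonoidAlgebra ℝ G) where
  star_smul r x := congrArg MulOpposite.unop (map_smul (invAntiHom G) r x)

lemma coeff_star (x : MonoidAlgebra ℝ G) (g : G) : (star x).coeff g = x.coeff g⁻¹ := by
  classical
  induction x using induction_linear with
  | zero => simp
  | add x y hx hy => simp [hx, hy]
  | single h r => simp [star_single_eq, Finsupp.single_apply, inv_eq_iff_eq_inv]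

/-- The coefficient at the identity. -/
noncomputable def coeffOne (G : Type*) [Group G] : MonoidAlgebra ℝ G →ₗ[ℝ] ℝ where
  toFun x := x.coeff 1
  map_add' _ _ := rfl
  map_smul' _ _ := rfl

lemma coeffOne_star_mul_self (x : MonoidAlgebra ℝ G) :
    coeffOne G (star x * x) = ∑ g ∈ x.coeff.support, x.coeff g ^ 2 := by
  change (star x * x).coeff 1 = _
  simp [coeff_mul_apply_right, coeff_star, Finsupp.sum, sq]

lemma isFaithfulTrace_coeffOne : IsFaithfulTrace (coeffOne G) where
  mul_comm x y := by
    change (x * y).coeff 1 = (y * x).coeff 1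
    rw [coeff_mul_apply_left, coeff_mul_apply_right]
    simp [mul_comm]
  nonneg x := by
    rw [coeffOne_star_mul_self]
    positivity
  eq_zero x hx := by
    rw [coeffOne_star_mul_self, Finset.sum_eq_zero_iff_of_nonneg fun _ _ ↦ sq_nonneg _] at hx
    ext g
    by_contra hg
    exact hg (by simpa using hx g (by simpa using hg))

lemma isLeftBounded_coeffOne (a : MonoidAlgebra ℝ G) : IsLeftBounded (coeffOne G) a := by
  induction a using induction_linear with
  | zero => exact ⟨0, fun x ↦ by simp⟩
  | add a b ha hb => exact isFaithfulTrace_coeffOne.isLeftBounded_add ha hb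
  | single g r =>
    refine ⟨r * r, fun x ↦ le_of_eq ?_⟩
    have h : star (single g r * x) * (single g r * x) = (r * r) • (star x * x) := by
      rw [star_mul, star_single_eq, mul_assoc, ← mul_assoc (single g⁻¹ r), single_mul_single,
        inv_mul_cancel, ← mul_one (r * r), ← smul_eq_mul (r * r), ← smul_single, ← one_def]
      simp
    rw [h, map_smul, smul_eq_mul]

/-- **Kaplansky's theorem**: real group algebras are stably finite. -/
theorem isStablyFiniteRing_real : IsStablyFiniteRing (MonoidAlgebra ℝ G) :=
  haveI := starModule_real (G := G)
  isFaithfulTrace_coeffOne.isStablyFiniteRing isLeftBounded_coeffOne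

theorem isStablyFiniteRing_int : IsStablyFiniteRing (MonoidAlgebra ℤ G) :=
  haveI := isStablyFiniteRing_real (G := G)
  .of_injective (mapRingHom G (Int.castRingHom ℝ)) (map_injective _ Int.cast_injective)

end MonoidAlgebra

/-- A module over a stably finite ring whose sum with a finite free module is free of the same
rank is trivial. -/
theorem IsStablyFiniteRing.subsingleton_of_prod_equiv {R M : Type*} [Ring R]
    [IsStablyFiniteRing R] [AddCommGroup M] [Module R M] {n : ℕ}
    (e : (M × (Fin n → R)) ≃ₗ[R] (Fin n → R)) : Subsingleton M := by
  let f : (Fin n → R) →ₗ[R] (Fin n → R) := e.toLinearMap ∘ₗ LinearMap.inr R M (Fin n → R)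
  let g : (Fin n → R) →ₗ[R] (Fin n → R) := LinearMap.snd R M (Fin n → R) ∘ₗ e.symm.toLinearMap
  have hgf : g ∘ₗ f = LinearMap.id := by ext; simp [f, g]
  have hfg : f ∘ₗ g = LinearMap.id := by
    obtain ⟨A, hA⟩ := Matrix.toLinearMapRight'.surjective f
    obtain ⟨B, hB⟩ := Matrix.toLinearMapRight'.surjective g
    rw [← hA, ← hB, ← Matrix.toLinearMapRight'_mul, ← Matrix.toLinearMapRight'_one] at hgf ⊢
    rw [mul_eq_one_comm.mp (Matrix.toLinearMapRight'.injective hgf)]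
  refine subsingleton_of_forall_eq 0 fun m ↦ ?_
  have h := e.symm.injective.eq_iff.mpr (LinearMap.congr_fun hfg (e (m, 0)))
  simpa [f, g, eq_comm] using h

/-- If `M × Λⁿ ≃ Λⁿ` as modules over the integral group ring `Λ = ℤ[π]`, then `M` is trivial. -/
theorem subsingleton_of_prod_free_equiv_free
    (π : Type*) [Group π] (M : Type*) [AddCommGroup M] [Module (MonoidAlgebra ℤ π) M]
    (n : ℕ)
    (e : (M × (Fin n → MonoidAlgebra ℤ π)) ≃ₗ[MonoidAlgebra ℤ π] (Fin n → MonoidAlgebra ℤ π)) :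
    Subsingleton M :=
  haveI := MonoidAlgebra.isStablyFiniteRing_int (G := π)
  IsStablyFiniteRing.subsingleton_of_prod_equiv e
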